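/- Let d = 5. For a general binary quintic E: (I_E)_m = 0 for all m < 8, the degree-8 graded piece (I_E)_8 is one-dimensional, and every polynomial in (I_E)_8 is SL₂(ℂ)-invariant (fixed by the SL₂(ℂ)-action on R). -/

import Mathlib

/-!
Setup for the ideals of general binary orbits (Chipalkatti, "On the ideals of general
binary orbits: the low order cases").

A binary form `E = Σ_{i=0}^d binom(d,i) αᵢ x₁^{d−i} x₂^i` of order `d` over `ℂ` is
identified with its coefficient vector `α : Fin (d+1) → ℂ`.  `SL₂(ℂ)` acts on binary
`d`-ics by substitution of variables, inducing an action `actCoeff` on `ℂ^{d+1}` and an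
action `actPoly` on `R = ℂ[a_0, …, a_d]` (the polynomial ring `MvPolynomial (Fin (d+1)) ℂ`).

For `E ≠ 0`, `orbitVariety d E = X_E` is the Zariski closure of
`{λ • (g·E) : λ ∈ ℂ, g ∈ SL₂(ℂ)}` (the affine cone over the orbit closure `Ω_E ⊆ ℙ^d`),
and `orbitIdeal d E = I_E` is its vanishing ideal (automatically homogeneous).

`genPiece d m E = (I_E)_m`, `trivPiece d m E = (R₊·I_E)_m`, and
`minGenSpace d m E = B(0,m) = (I_E/(R₊·I_E))_m` is the space of minimal generators in
degree `m`, with `betti d m E = β_m` its dimension.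

`RepSum l` models the direct sum `⊕ᵢ S_{l i}` of the irreducible `SL₂(ℂ)`-representations
(binary forms of order `q`, via coefficient vectors), with action `repSumAct`.
-/

open MvPolynomial

noncomputable section

/-- The special linear group `SL₂(ℂ)`. -/
abbrev SL2 : Type := Matrix.SpecialLinearGroup (Fin 2) ℂ

/-- The binary form of order `d` with coefficient vector `α`:
`Σ_{i=0}^d binom(d,i) αᵢ x₁^{d−i} x₂^i`, with `x₁ = X 0`, `x₂ = X 1`. -/
def toForm (d : ℕ) (α : Fin (d + 1) → ℂ) : MvPolynomial (Fin 2) ℂ :=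
  ∑ i : Fin (d + 1), C ((d.choose (i : ℕ) : ℂ) * α i) * (X 0 ^ (d - (i : ℕ)) * X 1 ^ (i : ℕ))

/-- Substitution of variables by `g = [[p,q],[r,s]]`: `x₁ ↦ p x₁ + q x₂`, `x₂ ↦ r x₁ + s x₂`. -/
def substAction (g : SL2) (F : MvPolynomial (Fin 2) ℂ) : MvPolynomial (Fin 2) ℂ :=
  aeval (fun i : Fin 2 => C (g.1 i 0) * X 0 + C (g.1 i 1) * X 1) F

/-- The coefficient vector of `g·E`, where `E` is the binary `d`-ic with coefficient
vector `α`: the coefficient of `x₁^{d−i} x₂^i` in `g·E`, divided by `binom(d,i)`. -/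
def actCoeff (d : ℕ) (g : SL2) (α : Fin (d + 1) → ℂ) : Fin (d + 1) → ℂ := fun i =>
  coeff (Finsupp.single (0 : Fin 2) (d - (i : ℕ)) + Finsupp.single (1 : Fin 2) (i : ℕ))
      (substAction g (toForm d α)) / (d.choose (i : ℕ) : ℂ)

/-- The affine cone over the `SL₂(ℂ)`-orbit of `E`:
`{λ • (g·E) : λ ∈ ℂ, g ∈ SL₂(ℂ)} ⊆ ℂ^{d+1}`. -/
def orbitCone (d : ℕ) (E : Fin (d + 1) → ℂ) : Set (Fin (d + 1) → ℂ) :=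
  {v | ∃ (c : ℂ) (g : SL2), v = c • actCoeff d g E}

/-- The Zariski closure of a subset of affine space `ℂⁿ`: the set of points at which every
polynomial vanishing on `S` vanishes. -/
def zClosure {n : ℕ} (S : Set (Fin n → ℂ)) : Set (Fin n → ℂ) :=
  {v | ∀ f : MvPolynomial (Fin n) ℂ, (∀ w ∈ S, eval w f = 0) → eval v f = 0}

/-- A Zariski-open subset of `ℂⁿ`: the complement of the common zero locus of a family of
polynomials. -/
def IsZariskiOpen {n : ℕ} (U : Set (Fin n → ℂ)) : Prop :=
  ∃ T : Set (MvPolynomial (Fin n) ℂ), U = {v | ∃ f ∈ T, eval v f ≠ 0}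

/-- A Zariski-dense subset of `ℂⁿ`. -/
def IsZariskiDense {n : ℕ} (U : Set (Fin n → ℂ)) : Prop :=
  zClosure U = Set.univ

/-- A property `P` holds for a general `E ∈ ℂ^{d+1}` if it holds on some dense
Zariski-open subset of `ℂ^{d+1}`. -/
def ForGeneral (d : ℕ) (P : (Fin (d + 1) → ℂ) → Prop) : Prop :=
  ∃ U : Set (Fin (d + 1) → ℂ), IsZariskiOpen U ∧ IsZariskiDense U ∧ ∀ E ∈ U, P E

/-- `X_E`: the Zariski closure of the affine cone over the orbit of `E` (the affine cone
over the orbit closure `Ω_E ⊆ ℙ^d`). -/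
def orbitVariety (d : ℕ) (E : Fin (d + 1) → ℂ) : Set (Fin (d + 1) → ℂ) :=
  zClosure (orbitCone d E)

/-- `I_E`: the (homogeneous) vanishing ideal of `X_E` in `R = ℂ[a_0, …, a_d]`. -/
def orbitIdeal (d : ℕ) (E : Fin (d + 1) → ℂ) : Ideal (MvPolynomial (Fin (d + 1)) ℂ) where
  carrier := {f | ∀ v ∈ orbitVariety d E, eval v f = 0}
  zero_mem' := fun v _ => by simp
  add_mem' := fun hf hh v hv => by simp [hf v hv, hh v hv]
  smul_mem' := fun c f hf v hv => by simp [smul_eq_mul, hf v hv]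

/-- The linear polynomial expressing the `i`-th coordinate of `g·v` in terms of the
coordinates of `v`. -/
def actVarPoly (d : ℕ) (g : SL2) (i : Fin (d + 1)) : MvPolynomial (Fin (d + 1)) ℂ :=
  ∑ j : Fin (d + 1), C (actCoeff d g (Pi.single j 1) i) * X j

/-- The induced `SL₂(ℂ)`-action on `R = ℂ[a_0, …, a_d]`: `(g·f)(v) = f(g·v)`. -/
def actPoly (d : ℕ) (g : SL2) (f : MvPolynomial (Fin (d + 1)) ℂ) :
    MvPolynomial (Fin (d + 1)) ℂ :=
  aeval (actVarPoly d g) f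

/-- The degree-`m` graded piece of an ideal of `R`, as a `ℂ`-subspace. -/
def idealPiece (d m : ℕ) (I : Ideal (MvPolynomial (Fin (d + 1)) ℂ)) :
    Submodule ℂ (MvPolynomial (Fin (d + 1)) ℂ) :=
  Submodule.restrictScalars ℂ I ⊓ homogeneousSubmodule (Fin (d + 1)) ℂ m

/-- `(I_E)_m`, the degree-`m` graded piece of `I_E`. -/
def genPiece (d m : ℕ) (E : Fin (d + 1) → ℂ) :
    Submodule ℂ (MvPolynomial (Fin (d + 1)) ℂ) :=
  idealPiece d m (orbitIdeal d E)

/-- The irrelevant maximal ideal `R₊ = (a_0, …, a_d)`. -/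
def irrelevantIdeal (d : ℕ) : Ideal (MvPolynomial (Fin (d + 1)) ℂ) :=
  Ideal.span (Set.range X)

/-- `(R₊·I_E)_m`. -/
def trivPiece (d m : ℕ) (E : Fin (d + 1) → ℂ) :
    Submodule ℂ (MvPolynomial (Fin (d + 1)) ℂ) :=
  idealPiece d m (irrelevantIdeal d * orbitIdeal d E)

/-- `(R₊·I_E)_m` viewed inside `(I_E)_m`. -/
def minGenRel (d m : ℕ) (E : Fin (d + 1) → ℂ) : Submodule ℂ (genPiece d m E) :=
  (trivPiece d m E).comap (genPiece d m E).subtype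

/-- `B(0,m) = (I_E/(R₊·I_E))_m`, the degree-`m` space of minimal generators of `I_E`. -/
abbrev minGenSpace (d m : ℕ) (E : Fin (d + 1) → ℂ) : Type :=
  genPiece d m E ⧸ minGenRel d m E

/-- The canonical projection `(I_E)_m → B(0,m)`. -/
def minGenMk (d m : ℕ) (E : Fin (d + 1) → ℂ) : genPiece d m E →ₗ[ℂ] minGenSpace d m E :=
  (minGenRel d m E).mkQ

/-- `β_m = dim_ℂ B(0,m)`, the number of minimal generators of `I_E` in degree `m`. -/
def betti (d m : ℕ) (E : Fin (d + 1) → ℂ) : ℕ :=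
  Module.finrank ℂ (minGenSpace d m E)

/-- The direct sum `⊕ᵢ S_{l i}` of irreducible `SL₂(ℂ)`-representations, where `S_q`
(binary forms of order `q`) is modeled by coefficient vectors `Fin (q+1) → ℂ`. -/
abbrev RepSum (l : List ℕ) : Type :=
  ∀ i : Fin l.length, Fin (l.get i + 1) → ℂ

/-- The `SL₂(ℂ)`-action on `RepSum l`, by substitution on each binary form. -/
def repSumAct (l : List ℕ) (g : SL2) (v : RepSum l) : RepSum l :=
  fun i => actCoeff (l.get i) g (v i)

/-- `B(0,m) ≅ S_{l 0} ⊕ ⋯ ⊕ S_{l k}` as `SL₂(ℂ)`-representations: there is a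
`ℂ`-linear isomorphism intertwining the action induced on `B(0,m)` by the action on
`(I_E)_m ⊆ R` with the action on `⊕ᵢ S_{l i}`. -/
def HasMinGens (d m : ℕ) (E : Fin (d + 1) → ℂ) (l : List ℕ) : Prop :=
  ∃ e : minGenSpace d m E ≃ₗ[ℂ] RepSum l,
    ∀ (g : SL2) (f : MvPolynomial (Fin (d + 1)) ℂ)
      (hf : f ∈ genPiece d m E) (hgf : actPoly d g f ∈ genPiece d m E),
      e (minGenMk d m E ⟨actPoly d g f, hgf⟩) = repSumAct l g (e (minGenMk d m E ⟨f, hf⟩))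

end

/-! ### The action on quintic coefficient vectors -/

/-- The coefficient vector of `E(p x₁ + q x₂, r x₁ + s x₂)` for a quintic `E` with coefficient
vector `a`, over an arbitrary commutative ring. -/
def quinticSubst {R : Type*} [CommRing R] (p q r s : R) (a : Fin 6 → R) : Fin 6 → R :=
  ![p ^ 5 * a 0 +
      5 * p ^ 4 * r * a 1 +
      10 * p ^ 3 * r ^ 2 * a 2 +
      10 * p ^ 2 * r ^ 3 * a 3 +
      5 * p * r ^ 4 * a 4 +
      r ^ 5 * a 5,
    p ^ 4 * q * a 0 +
      (p ^ 4 * s + 4 * p ^ 3 * r * q) * a 1 +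
      (4 * p ^ 3 * r * s + 6 * p ^ 2 * r ^ 2 * q) * a 2 +
      (6 * p ^ 2 * r ^ 2 * s + 4 * p * r ^ 3 * q) * a 3 +
      (4 * p * r ^ 3 * s + r ^ 4 * q) * a 4 +
      r ^ 4 * s * a 5,
    p ^ 3 * q ^ 2 * a 0 +
      (2 * p ^ 3 * q * s + 3 * p ^ 2 * r * q ^ 2) * a 1 +
      (p ^ 3 * s ^ 2 + 6 * p ^ 2 * r * q * s + 3 * p * r ^ 2 * q ^ 2) * a 2 +
      (3 * p ^ 2 * r * s ^ 2 + 6 * p * r ^ 2 * q * s + r ^ 3 * q ^ 2) * a 3 +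
      (3 * p * r ^ 2 * s ^ 2 + 2 * r ^ 3 * q * s) * a 4 +
      r ^ 3 * s ^ 2 * a 5,
    p ^ 2 * q ^ 3 * a 0 +
      (3 * p ^ 2 * q ^ 2 * s + 2 * p * r * q ^ 3) * a 1 +
      (3 * p ^ 2 * q * s ^ 2 + 6 * p * r * q ^ 2 * s + r ^ 2 * q ^ 3) * a 2 +
      (p ^ 2 * s ^ 3 + 6 * p * r * q * s ^ 2 + 3 * r ^ 2 * q ^ 2 * s) * a 3 +
      (2 * p * r * s ^ 3 + 3 * r ^ 2 * q * s ^ 2) * a 4 +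
      r ^ 2 * s ^ 3 * a 5,
    p * q ^ 4 * a 0 +
      (4 * p * q ^ 3 * s + r * q ^ 4) * a 1 +
      (6 * p * q ^ 2 * s ^ 2 + 4 * r * q ^ 3 * s) * a 2 +
      (4 * p * q * s ^ 3 + 6 * r * q ^ 2 * s ^ 2) * a 3 +
      (p * s ^ 4 + 4 * r * q * s ^ 3) * a 4 +
      r * s ^ 4 * a 5,
    q ^ 5 * a 0 +
      5 * q ^ 4 * s * a 1 +
      10 * q ^ 3 * s ^ 2 * a 2 +
      10 * q ^ 2 * s ^ 3 * a 3 +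
      5 * q * s ^ 4 * a 4 +
      s ^ 5 * a 5]

lemma coeff_toForm_quintic (a : Fin 6 → ℂ) (i : Fin 6) :
    coeff (Finsupp.single (0 : Fin 2) (5 - (i : ℕ)) + Finsupp.single (1 : Fin 2) (i : ℕ))
      (toForm 5 a) = ((5 : ℕ).choose (i : ℕ) : ℂ) * a i := by
  have hmon : ∀ j : Fin 6, C (((5 : ℕ).choose (j : ℕ) : ℂ) * a j) *
      (X 0 ^ (5 - (j : ℕ)) * X 1 ^ (j : ℕ) : MvPolynomial (Fin 2) ℂ) =
      monomial (Finsupp.single 0 (5 - (j : ℕ)) + Finsupp.single 1 (j : ℕ))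
        (((5 : ℕ).choose (j : ℕ) : ℂ) * a j) := fun j => by
    rw [X_pow_eq_monomial, X_pow_eq_monomial, monomial_mul, C_mul_monomial]
    simp
  simp only [toForm, coeff_sum]
  rw [Finset.sum_eq_single i]
  · rw [hmon, coeff_monomial, if_pos rfl]
  · intro j _ hj
    rw [hmon, coeff_monomial, if_neg]
    intro h
    have := DFunLike.congr_fun h 1
    simp at this
    exact hj (Fin.ext this)
  · simp

lemma substAction_toForm_quintic (g : SL2) (a : Fin 6 → ℂ) :
    substAction g (toForm 5 a) =
      toForm 5 (quinticSubst (g.1 0 0) (g.1 0 1) (g.1 1 0) (g.1 1 1) a) := by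
  simp only [substAction, toForm, quinticSubst, Fin.sum_univ_succ, map_add, map_mul, map_pow,
    aeval_X, aeval_C, algebraMap_eq]
  have hC (n : ℕ) [n.AtLeastTwo] : (C ofNat(n) : MvPolynomial (Fin 2) ℂ) = ofNat(n) := map_ofNat C n
  simp [Nat.choose, hC]
  ring

lemma actCoeff_quintic (g : SL2) (a : Fin 6 → ℂ) :
    actCoeff 5 g a = quinticSubst (g.1 0 0) (g.1 0 1) (g.1 1 0) (g.1 1 1) a := by
  funext i
  have h : ((5 : ℕ).choose (i : ℕ) : ℂ) ≠ 0 :=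
    Nat.cast_ne_zero.mpr (Nat.choose_pos (Nat.lt_succ_iff.mp i.2)).ne'
  rw [actCoeff, substAction_toForm_quintic, coeff_toForm_quintic]
  exact mul_div_cancel_left₀ _ h

lemma substAction_mul (g h : SL2) (F : MvPolynomial (Fin 2) ℂ) :
    substAction h (substAction g F) = substAction (g * h) F := by
  simp only [substAction, ← AlgHom.comp_apply, comp_aeval]
  congr 2
  funext i
  simp [Matrix.mul_apply, Fin.sum_univ_two]
  ring

lemma actCoeff_mul (g h : SL2) (a : Fin 6 → ℂ) :
    actCoeff 5 h (actCoeff 5 g a) = actCoeff 5 (g * h) a := by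
  have hg : toForm 5 (actCoeff 5 g a) = substAction g (toForm 5 a) := by
    rw [actCoeff_quintic, substAction_toForm_quintic]
  funext i
  simp only [actCoeff] at hg ⊢
  rw [hg, substAction_mul]

lemma quinticSubst_smul {R : Type*} [CommRing R] (p q r s c : R) (a : Fin 6 → R) :
    quinticSubst p q r s (c • a) = c • quinticSubst p q r s a := by
  funext i
  fin_cases i <;> simp [quinticSubst] <;> ring

lemma quinticSubst_scalar {R : Type*} [CommRing R] (p q r s c : R) (a : Fin 6 → R) :
    quinticSubst (c * p) (c * q) (c * r) (c * s) a = c ^ 5 • quinticSubst p q r s a := by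
  funext i
  fin_cases i <;> simp [quinticSubst] <;> ring

lemma quinticSubst_eq_sum {R : Type*} [CommRing R] (p q r s : R) (a : Fin 6 → R) (i : Fin 6) :
    quinticSubst p q r s a i = ∑ j, quinticSubst p q r s (Pi.single j 1) i * a j := by
  simp only [Fin.sum_univ_succ]
  fin_cases i <;> simp [quinticSubst, Pi.single_apply, Fin.ext_iff] <;> ring

lemma smul_mem_orbitCone {E v : Fin 6 → ℂ} (hv : v ∈ orbitCone 5 E) (c : ℂ) :
    c • v ∈ orbitCone 5 E := by
  obtain ⟨b, g, rfl⟩ := hv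
  exact ⟨c * b, g, (mul_smul _ _ _).symm⟩

/-- The cone over an orbit is stable under all invertible substitutions. -/
lemma quinticSubst_mem_orbitCone {E v : Fin 6 → ℂ} (hv : v ∈ orbitCone 5 E) {p q r s : ℂ}
    (hdet : p * s - q * r ≠ 0) : quinticSubst p q r s v ∈ orbitCone 5 E := by
  obtain ⟨b, g, rfl⟩ := hv
  obtain ⟨c, hc⟩ := IsSquare.exists_sq (p * s - q * r) (Complex.isSquare _)
  have hc0 : c ≠ 0 := by
    rintro rfl
    exact hdet (by simpa using hc)
  let h : SL2 := ⟨!![p / c, q / c; r / c, s / c], by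
    rw [Matrix.det_fin_two_of]
    field_simp
    linear_combination hc⟩
  refine ⟨c ^ 5 * b, g * h, ?_⟩
  rw [← actCoeff_mul, quinticSubst_smul, mul_comm, mul_smul, actCoeff_quintic h,
    ← quinticSubst_scalar]
  simp [h, mul_div_cancel₀ _ hc0]

lemma self_mem_orbitCone (E : Fin 6 → ℂ) : E ∈ orbitCone 5 E := by
  refine ⟨1, 1, ?_⟩
  rw [actCoeff_quintic, one_smul]
  funext i
  fin_cases i <;> simp [quinticSubst]

lemma eval_actPoly (g : SL2) (f : MvPolynomial (Fin 6) ℂ) (v : Fin 6 → ℂ) :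
    eval v (actPoly 5 g f) = eval (actCoeff 5 g v) f := by
  refine RingHom.congr_fun (f := (eval v).comp (aeval (actVarPoly 5 g)).toRingHom)
    (g := eval (actCoeff 5 g v)) (ringHom_ext (fun c => ?_) fun i => ?_) f
  · simp
  · have h := quinticSubst_eq_sum (g.1 0 0) (g.1 0 1) (g.1 1 0) (g.1 1 1) v i
    simp only [← actCoeff_quintic] at h
    simp [actVarPoly, h]

/-! ### Invariants of quintics -/

/-- The quadratic covariant of degree two of a quintic, as a list of three coefficients. -/
def quadCov {R : Type*} [CommRing R] (a : Fin 6 → R) : Fin 3 → R :=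
  ![a 0 * a 4 - 4 * a 1 * a 3 + 3 * a 2 ^ 2, a 0 * a 5 - 3 * a 1 * a 4 + 2 * a 2 * a 3,
    a 1 * a 5 - 4 * a 2 * a 4 + 3 * a 3 ^ 2]

/-- The minor of the Hankel matrix `(a_{i+j})` on three rows and on the columns `i, j, k`. -/
def hankelMinor {R : Type*} [CommRing R] (a : Fin 6 → R) (i j k : Fin 4) : R :=
  !![a (i.castLE (by decide)), a (j.castLE (by decide)), a (k.castLE (by decide));
    a (i.succ.castLE (by decide)), a (j.succ.castLE (by decide)), a (k.succ.castLE (by decide));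
    a i.succ.succ, a j.succ.succ, a k.succ.succ].det

/-- The cubic covariant of degree three (the canonizant) of a quintic. -/
def cubicCov {R : Type*} [CommRing R] (a : Fin 6 → R) : Fin 4 → R :=
  ![hankelMinor a 0 1 2, hankelMinor a 0 1 3, hankelMinor a 0 2 3, hankelMinor a 1 2 3]

/-- The Hessian covariant of a binary cubic `c₀x³ + c₁x²y + c₂xy² + c₃y³`, up to a factor. -/
def cubicHessian {R : Type*} [CommRing R] (c : Fin 4 → R) : Fin 3 → R :=
  ![c 1 ^ 2 - 3 * c 0 * c 2, c 1 * c 2 - 9 * c 0 * c 3, c 2 ^ 2 - 3 * c 1 * c 3]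

/-- The joint invariant of two binary quadratics. -/
def quadPairing {R : Type*} [CommRing R] (b c : Fin 3 → R) : R :=
  2 * b 0 * c 2 - b 1 * c 1 + 2 * b 2 * c 0

/-- The invariant of degree four of a quintic. -/
def invariantFour {R : Type*} [CommRing R] (a : Fin 6 → R) : R :=
  quadPairing (quadCov a) (quadCov a)

/-- An invariant of degree eight of a quintic. -/
def invariantEight {R : Type*} [CommRing R] (a : Fin 6 → R) : R :=
  quadPairing (quadCov a) (cubicHessian (cubicCov a))

section Equivariance

variable {R : Type*} [CommRing R]

/-- Substitution of `x + t y` for `x` in a binary quadratic. -/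
def quadShift (t : R) (b : Fin 3 → R) : Fin 3 → R :=
  ![b 0, b 1 + 2 * t * b 0, b 2 + t * b 1 + t ^ 2 * b 0]

/-- Substitution of `x + t y` for `x` in a binary cubic. -/
def cubicShift (t : R) (c : Fin 4 → R) : Fin 4 → R :=
  ![c 0, c 1 + 3 * t * c 0, c 2 + 2 * t * c 1 + 3 * t ^ 2 * c 0,
    c 3 + t * c 2 + t ^ 2 * c 1 + t ^ 3 * c 0]

lemma quadCov_upper (t : R) (a : Fin 6 → R) :
    quadCov (quinticSubst 1 t 0 1 a) = quadShift t (quadCov a) := by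
  funext i
  fin_cases i <;> simp [quadCov, quinticSubst, quadShift] <;> ring

lemma cubicCov_upper (t : R) (a : Fin 6 → R) :
    cubicCov (quinticSubst 1 t 0 1 a) = cubicShift t (cubicCov a) := by
  funext i
  fin_cases i <;>
    simp [cubicCov, hankelMinor, Matrix.det_fin_three, quinticSubst, cubicShift] <;> ring

lemma cubicHessian_shift (t : R) (c : Fin 4 → R) :
    cubicHessian (cubicShift t c) = quadShift t (cubicHessian c) := by
  funext i
  fin_cases i <;> simp [cubicHessian, quadShift, cubicShift] <;> ring

lemma quadPairing_shift (t : R) (b c : Fin 3 → R) :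
    quadPairing (quadShift t b) (quadShift t c) = quadPairing b c := by
  simp [quadPairing, quadShift]
  ring

lemma quadCov_rev (a : Fin 6 → R) : quadCov (a ∘ Fin.rev) = quadCov a ∘ Fin.rev := by
  funext i
  fin_cases i <;> simp [quadCov, Fin.rev] <;> ring

lemma cubicCov_rev (a : Fin 6 → R) : cubicCov (a ∘ Fin.rev) = cubicCov a ∘ Fin.rev := by
  funext i
  fin_cases i <;> simp [cubicCov, hankelMinor, Matrix.det_fin_three, Fin.rev] <;> ring

lemma cubicHessian_rev (c : Fin 4 → R) :
    cubicHessian (c ∘ Fin.rev) = cubicHessian c ∘ Fin.rev := by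
  funext i
  fin_cases i <;> simp [cubicHessian, Fin.rev] <;> ring

lemma quadPairing_rev (b c : Fin 3 → R) :
    quadPairing (b ∘ Fin.rev) (c ∘ Fin.rev) = quadPairing b c := by
  simp [quadPairing, Fin.rev]
  ring

lemma invariantFour_upper (t : R) (a : Fin 6 → R) :
    invariantFour (quinticSubst 1 t 0 1 a) = invariantFour a := by
  simp only [invariantFour, quadCov_upper, quadPairing_shift]

lemma invariantEight_upper (t : R) (a : Fin 6 → R) :
    invariantEight (quinticSubst 1 t 0 1 a) = invariantEight a := by
  simp only [invariantEight, quadCov_upper, cubicCov_upper, cubicHessian_shift, quadPairing_shift]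

lemma invariantFour_rev (a : Fin 6 → R) : invariantFour (a ∘ Fin.rev) = invariantFour a := by
  simp only [invariantFour, quadCov_rev, quadPairing_rev]

lemma invariantEight_rev (a : Fin 6 → R) : invariantEight (a ∘ Fin.rev) = invariantEight a := by
  simp only [invariantEight, quadCov_rev, cubicCov_rev, cubicHessian_rev, quadPairing_rev]

lemma invariantFour_smul (c : R) (a : Fin 6 → R) :
    invariantFour (c • a) = c ^ 4 * invariantFour a := by
  simp [invariantFour, quadPairing, quadCov]
  ring

lemma invariantEight_smul (c : R) (a : Fin 6 → R) :
    invariantEight (c • a) = c ^ 8 * invariantEight a := by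
  have h2 : quadCov (c • a) = c ^ 2 • quadCov a := by
    funext i
    fin_cases i <;> simp [quadCov] <;> ring
  have h3 : cubicCov (c • a) = c ^ 3 • cubicCov a := by
    funext i
    fin_cases i <;> simp [cubicCov, hankelMinor, Matrix.det_fin_three] <;> ring
  rw [invariantEight, h2, h3]
  simp [invariantEight, quadPairing, cubicHessian]
  ring

lemma map_invariantFour {S : Type*} [CommRing S] (φ : R →+* S) (a : Fin 6 → R) :
    φ (invariantFour a) = invariantFour (φ ∘ a) := by
  have hφ (n : ℕ) [n.AtLeastTwo] : φ ofNat(n) = ofNat(n) := map_ofNat φ n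
  simp [invariantFour, quadPairing, quadCov, hφ]

lemma map_invariantEight {S : Type*} [CommRing S] (φ : R →+* S) (a : Fin 6 → R) :
    φ (invariantEight a) = invariantEight (φ ∘ a) := by
  have hφ (n : ℕ) [n.AtLeastTwo] : φ ofNat(n) = ofNat(n) := map_ofNat φ n
  simp [invariantEight, quadPairing, quadCov, cubicHessian, cubicCov, hankelMinor,
    Matrix.det_fin_three, hφ]

lemma quinticSubst_lower (t : R) (a : Fin 6 → R) :
    quinticSubst 1 0 t 1 a = quinticSubst 1 t 0 1 (a ∘ Fin.rev) ∘ Fin.rev := by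
  funext i
  fin_cases i <;> simp [quinticSubst, Fin.rev] <;> ring

end Equivariance

/-- A function on quintics that is invariant under the shifts `x ↦ x + t y` and under reversal
is `SL₂(ℂ)`-invariant. -/
lemma apply_actCoeff_eq_of_upper_of_rev {J : (Fin 6 → ℂ) → ℂ}
    (hu : ∀ t v, J (quinticSubst 1 t 0 1 v) = J v) (hrev : ∀ v, J (v ∘ Fin.rev) = J v)
    (g : SL2) (v : Fin 6 → ℂ) : J (actCoeff 5 g v) = J v := by
  let U (t : ℂ) : SL2 := ⟨!![1, t; 0, 1], by simp⟩
  let L (t : ℂ) : SL2 := ⟨!![1, 0; t, 1], by simp⟩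
  have hU (t v) : J (actCoeff 5 (U t) v) = J v := by
    rw [actCoeff_quintic]
    simpa [U] using hu t v
  have hL (t v) : J (actCoeff 5 (L t) v) = J v := by
    rw [actCoeff_quintic]
    have := quinticSubst_lower t v
    simp only [L, Matrix.cons_val', Matrix.of_apply, Matrix.cons_val_zero, Matrix.cons_val_one,
      Matrix.cons_val_fin_one]
    rw [this, hrev, hu, hrev]
  have key (g : SL2) (hg : g.1 1 0 ≠ 0) (v) : J (actCoeff 5 g v) = J v := by
    have hdet : g.1 0 0 * g.1 1 1 - g.1 0 1 * g.1 1 0 = 1 := by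
      rw [← Matrix.det_fin_two]
      exact g.2
    have : g = U ((g.1 0 0 - 1) / g.1 1 0) * L (g.1 1 0) * U ((g.1 1 1 - 1) / g.1 1 0) := by
      refine Subtype.ext ?_
      change g.1 = !![1, _; 0, 1] * !![1, 0; _, 1] * !![1, _; 0, 1]
      ext i j
      fin_cases i <;> fin_cases j <;>
        simp [Matrix.mul_apply, Fin.sum_univ_two] <;> field_simp <;> grind
    rw [this, ← actCoeff_mul, ← actCoeff_mul, hU, hL, hU]
  by_cases hg : g.1 1 0 = 0
  · have h11 : g.1 1 1 ≠ 0 := by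
      intro h
      have := g.2
      rw [Matrix.det_fin_two, hg, h] at this
      simp at this
    rw [← hL 1 (actCoeff 5 g v), actCoeff_mul]
    refine key _ ?_ _
    change (g.1 * (!![1, 0; 1, 1] : Matrix (Fin 2) (Fin 2) ℂ)) 1 0 ≠ 0
    simpa [Matrix.mul_apply, Fin.sum_univ_two, hg] using h11
  · exact key g hg v

/-! ### Weights -/

section Weights

variable {n : ℕ}

lemma eval_weight_smul {ω : Fin n → ℕ} {f : MvPolynomial (Fin n) ℂ} {m : ℕ}
    (hf : IsWeightedHomogeneous ω f m) (c : ℂ) (v : Fin n → ℂ) :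
    eval (fun i => c ^ ω i * v i) f = c ^ m * eval v f := by
  rw [eval_eq', eval_eq', Finset.mul_sum]
  refine Finset.sum_congr rfl fun d hd => ?_
  have h := hf (mem_support_iff.mp hd)
  rw [Finsupp.weight_apply, Finsupp.sum_fintype _ _ (by simp)] at h
  simp only [mul_pow, Finset.prod_mul_distrib, ← pow_mul, Finset.prod_pow_eq_pow_sum]
  rw [← h]
  simp only [smul_eq_mul, mul_comm]
  ring

/-- Along a one-parameter group of weighted scalings, the value of a polynomial is a univariate
polynomial whose coefficients are the values of the weighted homogeneous components. -/
lemma exists_polynomial_eval_weight (ω : Fin n → ℕ) (f : MvPolynomial (Fin n) ℂ)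
    (v : Fin n → ℂ) : ∃ P : Polynomial ℂ,
      (∀ c, P.eval c = eval (fun i => c ^ ω i * v i) f) ∧
        ∀ m, P.coeff m = eval v (weightedHomogeneousComponent ω m f) := by
  set N := weightedTotalDegree ω f + 1
  have hN (m : ℕ) (hm : N ≤ m) : weightedHomogeneousComponent ω m f = 0 :=
    weightedHomogeneousComponent_eq_zero _ _ (Nat.lt_of_succ_le hm)
  have hsum : f = ∑ m ∈ Finset.range N, weightedHomogeneousComponent ω m f := by
    conv_lhs => rw [← sum_weightedHomogeneousComponent ω f]
    refine finsum_eq_sum_of_support_subset _ fun m hm => ?_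
    by_contra h
    exact hm (hN m (by simpa using h))
  refine ⟨∑ m ∈ Finset.range N,
    Polynomial.monomial m (eval v (weightedHomogeneousComponent ω m f)), fun c => ?_, fun m => ?_⟩
  · conv_rhs => rw [hsum]
    simp only [Polynomial.eval_finsetSum, Polynomial.eval_monomial, map_sum]
    refine Finset.sum_congr rfl fun m _ => ?_
    rw [eval_weight_smul (weightedHomogeneousComponent_isWeightedHomogeneous m f), mul_comm]
  · simp only [Polynomial.finsetSum_coeff, Polynomial.coeff_monomial]
    rw [Finset.sum_ite_eq']
    split_ifs with h
    · rfl
    · rw [hN m (by simpa using h), map_zero]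

lemma isWeightedHomogeneous_of_eval_eq {ω : Fin n → ℕ} {f : MvPolynomial (Fin n) ℂ} {m : ℕ}
    (hf : ∀ c v, eval (fun i => c ^ ω i * v i) f = c ^ m * eval v f) :
    IsWeightedHomogeneous ω f m := by
  have : weightedHomogeneousComponent ω m f = f := by
    refine MvPolynomial.funext fun v => ?_
    obtain ⟨P, hP, hc⟩ := exists_polynomial_eval_weight ω f v
    have : P = Polynomial.monomial m (eval v f) := Polynomial.funext fun c => by
      rw [hP, hf, Polynomial.eval_monomial, mul_comm]
    rw [← hc, this, Polynomial.coeff_monomial_same]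
  rw [← this]
  exact weightedHomogeneousComponent_isWeightedHomogeneous m f

lemma eval_smul_of_isHomogeneous {f : MvPolynomial (Fin n) ℂ} {m : ℕ} (hf : f.IsHomogeneous m)
    (c : ℂ) (v : Fin n → ℂ) : eval (c • v) f = c ^ m * eval v f := by
  rw [← eval_weight_smul hf c v]
  simp [Pi.smul_def]

lemma isHomogeneous_of_eval_smul {f : MvPolynomial (Fin n) ℂ} {m : ℕ}
    (hf : ∀ (c : ℂ) v, eval (c • v) f = c ^ m * eval v f) : f.IsHomogeneous m :=
  isWeightedHomogeneous_of_eval_eq fun c v => by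
    rw [← hf]
    simp [Pi.smul_def]

lemma polynomial_eq_zero_of_eval_eq_zero {P : Polynomial ℂ} (h : ∀ c, c ≠ 0 → P.eval c = 0) :
    P = 0 :=
  Polynomial.eq_zero_of_infinite_isRoot _ <|
    (Set.finite_singleton (0 : ℂ)).infinite_compl.mono fun c hc => h c hc

/-- A set stable under weighted scalings has a weighted homogeneous ideal. -/
lemma eval_weightedHomogeneousComponent_eq_zero {ω : Fin n → ℕ} {S : Set (Fin n → ℂ)}
    (hS : ∀ v ∈ S, ∀ c : ℂ, c ≠ 0 → (fun i => c ^ ω i * v i) ∈ S) {f : MvPolynomial (Fin n) ℂ}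
    (hf : ∀ v ∈ S, eval v f = 0) (m : ℕ) {v : Fin n → ℂ} (hv : v ∈ S) :
    eval v (weightedHomogeneousComponent ω m f) = 0 := by
  obtain ⟨P, hP, hc⟩ := exists_polynomial_eval_weight ω f v
  rw [← hc, polynomial_eq_zero_of_eval_eq_zero fun c hc => (hP c).trans (hf _ (hS v hv c hc)),
    Polynomial.coeff_zero]

lemma isHomogeneous_weightedHomogeneousComponent {ω : Fin n → ℕ} {f : MvPolynomial (Fin n) ℂ}
    {k : ℕ} (hf : f.IsHomogeneous k) (m : ℕ) :
    (weightedHomogeneousComponent ω m f).IsHomogeneous k := fun d hd => hf fun h => hd <| by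
  classical
  rw [coeff_weightedHomogeneousComponent, h, ite_self]

lemma eq_zero_of_weightedHomogeneousComponent_eq_zero {ω : Fin n → ℕ}
    {f : MvPolynomial (Fin n) ℂ} (h : ∀ m, weightedHomogeneousComponent ω m f = 0) : f = 0 := by
  rw [← sum_weightedHomogeneousComponent ω f]
  simp [h]

lemma polynomial_eval_eq_of_eval_inv {P Q : Polynomial ℂ}
    (h : ∀ c, c ≠ 0 → Q.eval c = P.eval c⁻¹) (x : ℂ) : P.eval x = P.eval 0 := by
  suffices hd : P.natDegree = 0 by
    rw [Polynomial.eq_C_of_natDegree_eq_zero hd, Polynomial.eval_C, Polynomial.eval_C]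
  by_contra hd
  have hrev : P.reverse = Polynomial.X ^ P.natDegree * Q := by
    refine sub_eq_zero.mp (polynomial_eq_zero_of_eval_eq_zero fun c hc => ?_)
    let := invertibleOfNonzero (inv_ne_zero hc)
    have := Polynomial.eval₂_reverse_mul_pow (RingHom.id ℂ) c⁻¹ P
    simp only [invOf_eq_inv, inv_inv, Polynomial.eval₂_id] at this
    rw [Polynomial.eval_sub, Polynomial.eval_mul, h c hc, ← this]
    simp [field]
  have h0 := congrArg (fun p => Polynomial.coeff p 0) hrev
  simp only [Polynomial.mul_coeff_zero] at h0
  rw [Polynomial.coeff_zero_reverse, Polynomial.coeff_X_pow, if_neg (Ne.symm hd), zero_mul] at h0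
  rw [Polynomial.leadingCoeff_eq_zero.mp h0] at hd
  simp at hd

end Weights

/-! ### Elimination modulo a number -/

section Elimination

/-- Evaluates the first argument before passing it on. -/
def force {α : Type*} (n : ℕ) (k : ℕ → α) : α :=
  match n with
  | 0 => k 0
  | m + 1 => k (m + 1)

lemma force_eq {α : Type*} (n : ℕ) (k : ℕ → α) : force n k = k n := by
  cases n <;> rfl

/-- The combination `a • s - b • r` of two rows modulo `p`. -/
def combineRows (p a b : ℕ) : List ℕ → List ℕ → List ℕ
  | y :: s, z :: r => force ((a * y + (p - b % p) * z) % p) fun x => x :: combineRows p a b s r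
  | _, _ => []

/-- Clears the first column of a list of rows by means of the row `a :: r`. -/
def clearColumn (p a : ℕ) (r : List ℕ) : List (List ℕ) → List (List ℕ)
  | (b :: s) :: L => combineRows p a b s r :: clearColumn p a r L
  | _ => []

/-- Whether Gaussian elimination modulo `p` without pivoting succeeds. -/
def hasPivots (p : ℕ) : ℕ → List (List ℕ) → Bool
  | 0, _ => true
  | n + 1, (a :: r) :: L => a % p != 0 && hasPivots p n (clearColumn p a r L)
  | _, _ => false

/-- The pairing of a row with a vector. -/
def rowDot {p : ℕ} : List ℕ → List (ZMod p) → ZMod p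
  | a :: s, x :: xs => a * x + rowDot s xs
  | _, _ => 0

variable {p : ℕ}

lemma length_combineRows (a b : ℕ) : ∀ {s r : List ℕ}, s.length = r.length →
    (combineRows p a b s r).length = s.length
  | [], [], _ => rfl
  | _ :: _, _ :: _, h => by
    simp only [combineRows, force_eq, List.length_cons]
    rw [length_combineRows a b (by simpa using h)]

lemma rowDot_combineRows [NeZero p] (a b : ℕ) : ∀ {s r : List ℕ} (_ : s.length = r.length)
    (x : List (ZMod p)), rowDot (combineRows p a b s r) x = a * rowDot s x - b * rowDot r x
  | [], [], _, _ => by simp [combineRows, rowDot]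
  | _ :: _, _ :: _, _, [] => by simp [rowDot]
  | y :: s, z :: r, h, x :: xs => by
    have hb : ((p - b % p : ℕ) : ZMod p) = -b := by
      rw [Nat.cast_sub (Nat.mod_lt b (NeZero.pos p)).le]
      simp
    simp only [combineRows, force_eq, rowDot]
    rw [rowDot_combineRows a b (by simpa using h) xs]
    simp only [ZMod.natCast_mod, Nat.cast_add, Nat.cast_mul, hb]
    ring

lemma exists_of_mem_clearColumn {a : ℕ} {r t : List ℕ} : ∀ {L : List (List ℕ)},
    t ∈ clearColumn p a r L → ∃ b s, b :: s ∈ L ∧ t = combineRows p a b s r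
  | [], h => by simp [clearColumn] at h
  | [] :: _, h => by simp [clearColumn] at h
  | (b :: s) :: L, h => by
    rcases List.mem_cons.mp h with rfl | h
    · exact ⟨b, s, by simp, rfl⟩
    · obtain ⟨b', s', h1, h2⟩ := exists_of_mem_clearColumn h
      exact ⟨b', s', List.mem_cons_of_mem _ h1, h2⟩

/-- A matrix on which elimination succeeds has a trivial kernel. -/
lemma eq_zero_of_hasPivots [Fact p.Prime] : ∀ {n : ℕ} {L : List (List ℕ)}, hasPivots p n L →
    (∀ s ∈ L, s.length = n) → ∀ {x : List (ZMod p)}, x.length = n →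
      (∀ s ∈ L, rowDot s x = 0) → ∀ c ∈ x, c = 0
  | 0, _, _, _, x, hx, _ => by simp [List.length_eq_zero_iff.mp hx]
  | n + 1, [], h, _, _, _, _ => by simp [hasPivots] at h
  | n + 1, [] :: _, h, _, _, _, _ => by simp [hasPivots] at h
  | n + 1, (a :: r) :: L, _, _, [], hx, _ => by simp at hx
  | n + 1, (a :: r) :: L, h, hL, x :: xs, hx, h0 => by
    simp only [hasPivots, Bool.and_eq_true, bne_iff_ne, ne_eq] at h
    have ha : (a : ZMod p) ≠ 0 := fun ha =>
      h.1 (Nat.mod_eq_zero_of_dvd ((ZMod.natCast_eq_zero_iff a p).mp ha))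
    have hr : r.length = n := by simpa using hL (a :: r) (by simp)
    have hr0 : a * x + rowDot r xs = 0 := h0 (a :: r) (by simp)
    have hxs : ∀ c ∈ xs, c = 0 := by
      refine eq_zero_of_hasPivots h.2 (fun t ht => ?_) (by simpa using hx) fun t ht => ?_ <;>
        obtain ⟨b, s, hs, rfl⟩ := exists_of_mem_clearColumn ht <;>
        have hlen : s.length = n := by simpa using hL _ (List.mem_cons_of_mem _ hs)
      · rw [length_combineRows a b (hlen.trans hr.symm), hlen]
      · rw [rowDot_combineRows a b (hlen.trans hr.symm)]
        have hs0 : b * x + rowDot s xs = 0 := h0 (b :: s) (List.mem_cons_of_mem _ hs)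
        linear_combination (a : ZMod p) * hs0 - b * hr0
    have hdot : ∀ (s : List ℕ) (y : List (ZMod p)), (∀ c ∈ y, c = 0) → rowDot s y = 0 := by
      intro s
      induction s with
      | nil => simp [rowDot]
      | cons b s ih =>
        rintro (_ | ⟨c, y⟩) hy
        · rfl
        · rw [rowDot, hy c (by simp), ih y fun c hc => hy c (List.mem_cons_of_mem _ hc)]
          simp
    rw [hdot r xs hxs, add_zero] at hr0
    simpa [(mul_eq_zero.mp hr0).resolve_left ha] using hxs

lemma rowDot_ofFn : ∀ {n : ℕ} (s : Fin n → ℕ) (x : Fin n → ZMod p),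
    rowDot (List.ofFn s) (List.ofFn x) = ∑ j, s j * x j
  | 0, _, _ => by simp [rowDot]
  | n + 1, s, x => by
    rw [List.ofFn_succ, List.ofFn_succ, rowDot, rowDot_ofFn, Fin.sum_univ_succ]

lemma det_ne_zero_of_hasPivots [Fact p.Prime] {n : ℕ} (M : Matrix (Fin n) (Fin n) (ZMod p))
    (L : Fin n → Fin n → ℕ) (hL : ∀ i j, (L i j : ZMod p) = M i j)
    (h : hasPivots p n (List.ofFn fun i => List.ofFn (L i))) : M.det ≠ 0 := by
  intro h0
  obtain ⟨x, hx, hMx⟩ := Matrix.exists_mulVec_eq_zero_iff.mpr h0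
  refine hx (funext fun j => eq_zero_of_hasPivots h ?_ (x := List.ofFn x) (by simp) ?_ _
    (List.mem_ofFn.mpr ⟨j, rfl⟩))
  · simp only [List.mem_ofFn]
    rintro _ ⟨i, rfl⟩
    simp
  · simp only [List.mem_ofFn]
    rintro _ ⟨i, rfl⟩
    rw [rowDot_ofFn]
    simp only [hL]
    exact congrFun hMx i

end Elimination

/-! ### Monomials and test points on the slice `a₁ = 0` -/

section Slice

/-- The exponents of the monomials of degree eight and weight `w` not involving `a₁`. -/
def sliceExps (w : ℕ) : List (Fin 6 → ℕ) :=
  (List.range (w / 5 + 1)).reverse.flatMap fun e₅ =>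
    (List.range ((w - 5 * e₅) / 4 + 1)).reverse.flatMap fun e₄ =>
      (List.range ((w - 5 * e₅ - 4 * e₄) / 3 + 1)).reverse.flatMap fun e₃ =>
        if (w - 5 * e₅ - 4 * e₄ - 3 * e₃) % 2 = 0 ∧
            (w - 5 * e₅ - 4 * e₄ - 3 * e₃) / 2 + e₃ + e₄ + e₅ ≤ 8 then
          [![8 - ((w - 5 * e₅ - 4 * e₄ - 3 * e₃) / 2 + e₃ + e₄ + e₅), 0,
            (w - 5 * e₅ - 4 * e₄ - 3 * e₃) / 2, e₃, e₄, e₅]]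
        else []

lemma mem_sliceExps {w : ℕ} {e : Fin 6 → ℕ} (h1 : e 1 = 0)
    (hdeg : e 0 + e 2 + e 3 + e 4 + e 5 = 8) (hw : 2 * e 2 + 3 * e 3 + 4 * e 4 + 5 * e 5 = w) :
    e ∈ sliceExps w := by
  simp only [sliceExps, List.mem_flatMap, List.mem_reverse, List.mem_range]
  refine ⟨e 5, by omega, e 4, by omega, e 3, by omega, ?_⟩
  rw [if_pos (by omega), List.mem_singleton]
  funext i
  fin_cases i <;> simp <;> omega

variable {R S : Type*} [CommRing R] [CommRing S]

/-- The value of a monomial in six variables. -/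
def monomialValue {R : Type*} [CommSemiring R] (v : Fin 6 → R) (e : Fin 6 → ℕ) : R :=
  v 0 ^ e 0 * v 1 ^ e 1 * v 2 ^ e 2 * v 3 ^ e 3 * v 4 ^ e 4 * v 5 ^ e 5

/-- The quintic `x⁵ + y⁵`. -/
def fermatQuintic : Fin 6 → R :=
  ![1, 0, 0, 0, 0, 1]

/-- The translate of a quintic that has no term in `x⁴ y`. -/
def toSlice (v : Fin 6 → R) : Fin 6 → R :=
  quinticSubst 1 (-v 1) 0 (v 0) v

/-- The points of the slice at which polynomials of weight `w` are tested. -/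
def testPoint (w : ℕ) (E : Fin 6 → R) (i : ℕ) : Fin 6 → R :=
  if w = 20 ∧ i = 0 then fermatQuintic else toSlice (quinticSubst 1 0 ((i + 1 : ℕ) : R) 1 E)

/-- The values of the monomials of weight `w` at the test points. -/
def sliceMatrix (w : ℕ) (E : Fin 6 → R) :
    Matrix (Fin (sliceExps w).length) (Fin (sliceExps w).length) R :=
  Matrix.of fun i j => monomialValue (testPoint w E i) ((sliceExps w).get j)

lemma map_quinticSubst (φ : R →+* S) (p q r s : R) (a : Fin 6 → R) :
    φ ∘ quinticSubst p q r s a = quinticSubst (φ p) (φ q) (φ r) (φ s) (φ ∘ a) := by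
  have hφ (n : ℕ) [n.AtLeastTwo] : φ ofNat(n) = ofNat(n) := map_ofNat φ n
  funext i
  fin_cases i <;> simp [quinticSubst, hφ]

lemma map_toSlice (φ : R →+* S) (v : Fin 6 → R) : φ ∘ toSlice v = toSlice (φ ∘ v) := by
  simp [toSlice, map_quinticSubst]

lemma map_testPoint (φ : R →+* S) (w : ℕ) (E : Fin 6 → R) (i : ℕ) :
    φ ∘ testPoint w E i = testPoint w (φ ∘ E) i := by
  unfold testPoint
  split_ifs with h
  · funext k
    fin_cases k <;> simp [fermatQuintic]
  · simp [map_toSlice, map_quinticSubst]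

lemma map_monomialValue {R S : Type*} [CommSemiring R] [CommSemiring S] (φ : R →+* S) (v : Fin 6 → R) (e : Fin 6 → ℕ) :
    φ (monomialValue v e) = monomialValue (φ ∘ v) e := by
  simp [monomialValue]

lemma map_sliceMatrix (φ : R →+* S) (w : ℕ) (E : Fin 6 → R) :
    φ (sliceMatrix w E).det = (sliceMatrix w (φ ∘ E)).det := by
  rw [RingHom.map_det]
  congr 1
  ext i j
  simp [sliceMatrix, map_monomialValue, map_testPoint]

/-- A quintic for which all slice matrices are invertible. -/
def sampleQuintic : Fin 6 → ℤ :=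
  ![1, 0, 0, 1, 0, 1]

/-- The residues of the entries of the slice matrices of `sampleQuintic`. -/
def sampleEntry (p w : ℕ) (i j : Fin (sliceExps w).length) : ℕ :=
  monomialValue (fun k => (testPoint w sampleQuintic i k % p).toNat) ((sliceExps w).get j)

lemma cast_sampleEntry {p : ℕ} [NeZero p] (w : ℕ) (i j : Fin (sliceExps w).length) :
    (sampleEntry p w i j : ZMod p) =
      sliceMatrix w (Int.castRingHom (ZMod p) ∘ sampleQuintic) i j := by
  rw [sampleEntry, ← Nat.coe_castRingHom, map_monomialValue, sliceMatrix, Matrix.of_apply,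
    ← map_testPoint]
  congr 1
  funext k
  have hp : (p : ℤ) ≠ 0 := Nat.cast_ne_zero.mpr (NeZero.ne p)
  have h := Int.toNat_of_nonneg (Int.emod_nonneg (testPoint w sampleQuintic i k) hp)
  have h' := congrArg (Int.cast : ℤ → ZMod p) h
  rw [Int.cast_natCast, ZMod.intCast_mod] at h'
  exact h'

lemma hasPivots_sampleEntry : ∀ w < 21, hasPivots 1000003 (sliceExps w).length
    (List.ofFn fun i => List.ofFn (sampleEntry 1000003 w i)) := by
  decide +kernel

lemma det_sliceMatrix_X_ne_zero {w : ℕ} (hw : w < 21) :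
    (sliceMatrix w (X : Fin 6 → MvPolynomial (Fin 6) ℂ)).det ≠ 0 := by
  have hX : (map (Int.castRingHom ℂ)) ∘ (X : Fin 6 → MvPolynomial (Fin 6) ℤ) = X := by
    funext i
    simp
  rw [← hX, ← map_sliceMatrix]
  refine (map_ne_zero_iff _ (map_injective _ Int.cast_injective)).mpr fun h => ?_
  have : Fact (Nat.Prime 1000003) := ⟨by norm_num⟩
  refine det_ne_zero_of_hasPivots _ _ (cast_sampleEntry w) (hasPivots_sampleEntry w hw) ?_
  have hE : (eval₂Hom (Int.castRingHom (ZMod 1000003))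
      (Int.castRingHom (ZMod 1000003) ∘ sampleQuintic)) ∘ X =
      Int.castRingHom (ZMod 1000003) ∘ sampleQuintic := by
    funext i
    simp
  rw [← hE, ← map_sliceMatrix, h, map_zero]

end Slice

/-! ### The ideal of an orbit -/

section OrbitIdeal

lemma mem_orbitIdeal {d : ℕ} {E : Fin (d + 1) → ℂ} {f : MvPolynomial (Fin (d + 1)) ℂ} :
    f ∈ orbitIdeal d E ↔ ∀ v ∈ orbitCone d E, eval v f = 0 :=
  ⟨fun h v hv => h v fun _ hg => hg v hv, fun h _ hv => hv f h⟩

lemma mem_genPiece {d m : ℕ} {E : Fin (d + 1) → ℂ} {f : MvPolynomial (Fin (d + 1)) ℂ} :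
    f ∈ genPiece d m E ↔ (∀ v ∈ orbitCone d E, eval v f = 0) ∧ f.IsHomogeneous m := by
  rw [← mem_orbitIdeal]
  rfl

/-- The grading of `R` in which the `k`-th coordinate has weight `k`. -/
abbrev torusWeight : Fin 6 → ℕ := fun k => k

lemma torus_mem_orbitCone {E v : Fin 6 → ℂ} (hv : v ∈ orbitCone 5 E) {c : ℂ} (hc : c ≠ 0) :
    (fun k => c ^ torusWeight k * v k) ∈ orbitCone 5 E := by
  have h : (fun k => c ^ torusWeight k * v k) = quinticSubst 1 0 0 c v := by
    funext k
    fin_cases k <;> simp [quinticSubst, torusWeight]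
  rw [h]
  exact quinticSubst_mem_orbitCone hv (by simpa using hc)

lemma rev_mem_orbitCone {E v : Fin 6 → ℂ} (hv : v ∈ orbitCone 5 E) :
    v ∘ Fin.rev ∈ orbitCone 5 E := by
  have h : v ∘ Fin.rev = quinticSubst 0 1 1 0 v := by
    funext k
    fin_cases k <;> simp [quinticSubst, Fin.rev]
  rw [h]
  exact quinticSubst_mem_orbitCone hv (by simp)

lemma toSlice_mem_orbitCone {E v : Fin 6 → ℂ} (hv : v ∈ orbitCone 5 E) :
    toSlice v ∈ orbitCone 5 E := by
  by_cases h0 : v 0 = 0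
  · have h : toSlice v = (0 : ℂ) • v := by
      funext k
      fin_cases k <;> simp [toSlice, quinticSubst, h0]
    rw [h]
    exact smul_mem_orbitCone hv 0
  · exact quinticSubst_mem_orbitCone hv (by simpa using h0)

lemma weightedHomogeneousComponent_mem_genPiece {m : ℕ} {E : Fin 6 → ℂ}
    {f : MvPolynomial (Fin 6) ℂ} (hf : f ∈ genPiece 5 m E) (w : ℕ) :
    weightedHomogeneousComponent torusWeight w f ∈ genPiece 5 m E := by
  rw [mem_genPiece] at hf ⊢
  exact ⟨fun v hv => eval_weightedHomogeneousComponent_eq_zero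
    (fun _ hv _ hc => torus_mem_orbitCone hv hc) hf.1 w hv,
    isHomogeneous_weightedHomogeneousComponent hf.2 w⟩

/-- The polynomial `v ↦ f(x ↦ x + t y)`. -/
noncomputable def shiftPoly (t : ℂ) (f : MvPolynomial (Fin 6) ℂ) : MvPolynomial (Fin 6) ℂ :=
  aeval (quinticSubst 1 (C t) 0 1 X) f

lemma eval_shiftPoly (t : ℂ) (f : MvPolynomial (Fin 6) ℂ) (v : Fin 6 → ℂ) :
    eval v (shiftPoly t f) = eval (quinticSubst 1 t 0 1 v) f := by
  have h := map_quinticSubst (eval v) 1 (C t) 0 1 X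
  have hX : eval v ∘ X = v := by
    funext i
    simp
  simp only [map_one, map_zero, eval_C, hX] at h
  rw [shiftPoly, ← h, ← coe_aeval_eq_eval, ← coe_aeval_eq_eval]
  exact comp_aeval_apply _ (aeval v) f

/-- Elements of lowest weight in the ideal of an orbit are invariant under shifts. -/
lemma eval_quinticSubst_upper {m w : ℕ} {E : Fin 6 → ℂ}
    (hlow : ∀ w' < w, ∀ f ∈ genPiece 5 m E, IsWeightedHomogeneous torusWeight f w' → f = 0)
    {f : MvPolynomial (Fin 6) ℂ} (hf : f ∈ genPiece 5 m E)
    (hfw : IsWeightedHomogeneous torusWeight f w) (t : ℂ) (v : Fin 6 → ℂ) :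
    eval (quinticSubst 1 t 0 1 v) f = eval v f := by
  have hg : shiftPoly 1 f ∈ genPiece 5 m E := by
    rw [mem_genPiece] at hf ⊢
    refine ⟨fun v hv => ?_, isHomogeneous_of_eval_smul fun c v => ?_⟩
    · rw [eval_shiftPoly]
      exact hf.1 _ (quinticSubst_mem_orbitCone hv (by simp))
    · rw [eval_shiftPoly, eval_shiftPoly, quinticSubst_smul, eval_smul_of_isHomogeneous hf.2]
  obtain ⟨P, hP, hcoeff⟩ := exists_polynomial_eval_weight torusWeight (shiftPoly 1 f) v
  obtain ⟨G, hG⟩ : Polynomial.X ^ w ∣ P := by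
    refine Polynomial.X_pow_dvd_iff.mpr fun k hk => ?_
    rw [hcoeff, hlow k hk _ (weightedHomogeneousComponent_mem_genPiece hg k)
      (weightedHomogeneousComponent_isWeightedHomogeneous k _), map_zero]
  let Q : Polynomial ℂ := aeval (quinticSubst 1 Polynomial.X 0 1 (Polynomial.C ∘ v)) f
  have hQ (s : ℂ) : Q.eval s = eval (quinticSubst 1 s 0 1 v) f := by
    have h := map_quinticSubst (Polynomial.evalRingHom s) 1 Polynomial.X 0 1 (Polynomial.C ∘ v)
    have hv : Polynomial.evalRingHom s ∘ Polynomial.C ∘ v = v := by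
      funext i
      simp
    simp only [map_one, map_zero, Polynomial.coe_evalRingHom, Polynomial.eval_X] at h hv
    rw [hv] at h
    rw [← h, ← Polynomial.coe_aeval_eq_eval, ← coe_aeval_eq_eval]
    exact comp_aeval_apply _ (Polynomial.aeval s) f
  have hGQ (c : ℂ) (hc : c ≠ 0) : G.eval c = Q.eval c⁻¹ := by
    have h1 := hP c
    have h2 : quinticSubst 1 1 0 1 (fun k => c ^ torusWeight k * v k) =
        fun k => c ^ torusWeight k * quinticSubst 1 c⁻¹ 0 1 v k := by
      funext k
      fin_cases k <;> simp [quinticSubst, torusWeight] <;> field_simp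
    rw [hG, eval_shiftPoly, h2, eval_weight_smul hfw, ← hQ, Polynomial.eval_mul,
      Polynomial.eval_pow, Polynomial.eval_X] at h1
    exact mul_left_cancel₀ (pow_ne_zero w hc) h1
  have h := polynomial_eval_eq_of_eval_inv hGQ t
  have h0 : quinticSubst 1 0 0 1 v = v := by
    funext k
    fin_cases k <;> simp [quinticSubst]
  rwa [hQ, hQ, h0] at h

/-- On the slice `a₁ = 0`, a polynomial of degree eight and weight `w` is a combination of the
monomials with exponents `sliceExps w`. -/
lemma exists_eval_eq_sum_monomialValue {w : ℕ} {f : MvPolynomial (Fin 6) ℂ}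
    (hf : f.IsHomogeneous 8) (hfw : IsWeightedHomogeneous torusWeight f w) :
    ∃ c : Fin (sliceExps w).length → ℂ, ∀ v : Fin 6 → ℂ, v 1 = 0 →
      eval v f = ∑ j, monomialValue v ((sliceExps w).get j) * c j := by
  have hmem : (fun v : {v : Fin 6 → ℂ // v 1 = 0} => eval v.1 f) ∈ Submodule.span ℂ
      (Set.range fun j v => monomialValue v.1 ((sliceExps w).get j)) := by
    simp only [eval_eq']
    have : (fun v : {v : Fin 6 → ℂ // v 1 = 0} => ∑ d ∈ f.support, coeff d f * ∏ i, v.1 i ^ d i) =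
        ∑ d ∈ f.support, coeff d f • fun v => ∏ i, v.1 i ^ d i := by
      funext v
      simp
    rw [this]
    refine Submodule.sum_mem _ fun d hd => Submodule.smul_mem _ _ ?_
    by_cases h1 : d 1 = 0
    · have hdeg := hf (mem_support_iff.mp hd)
      have hwt := hfw (mem_support_iff.mp hd)
      rw [Finsupp.weight_apply, Finsupp.sum_fintype _ _ (by simp)] at hdeg hwt
      simp [Fin.sum_univ_succ, torusWeight, h1] at hdeg hwt
      have hd' : (d : Fin 6 → ℕ) ∈ sliceExps w := mem_sliceExps h1 (by omega) (by omega)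
      obtain ⟨j, hj⟩ := List.get_of_mem hd'
      refine Submodule.subset_span ⟨j, ?_⟩
      funext v
      simp only [hj, monomialValue, Fin.prod_univ_six]
    · convert Submodule.zero_mem _ with v
      exact Finset.prod_eq_zero (Finset.mem_univ 1) (by rw [v.2, zero_pow h1])
  obtain ⟨c, hc⟩ := (Submodule.mem_span_range_iff_exists_fun ℂ).mp hmem
  refine ⟨c, fun v hv => ?_⟩
  have := congrFun hc ⟨v, hv⟩
  simpa [mul_comm] using this.symm

/-- A shift-invariant polynomial of degree eight and weight `w` that vanishes at the test points
vanishes. -/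
lemma eq_zero_of_eval_testPoint {w : ℕ} {E : Fin 6 → ℂ} (hE : (sliceMatrix w E).det ≠ 0)
    {f : MvPolynomial (Fin 6) ℂ} (hf : f.IsHomogeneous 8)
    (hfw : IsWeightedHomogeneous torusWeight f w)
    (hinv : ∀ t v, eval (quinticSubst 1 t 0 1 v) f = eval v f)
    (hpt : ∀ i, eval (testPoint w E i) f = 0) : f = 0 := by
  obtain ⟨c, hc⟩ := exists_eval_eq_sum_monomialValue hf hfw
  have htp (i : ℕ) : testPoint w E i 1 = 0 := by
    unfold testPoint
    split_ifs
    · simp [fermatQuintic]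
    · simp [toSlice, quinticSubst]
      ring
  have hc0 : c = 0 := Matrix.eq_zero_of_mulVec_eq_zero hE <| funext fun i => by
    rw [Pi.zero_apply, ← hpt i, hc _ (htp i)]
    simp only [Matrix.mulVec, dotProduct, sliceMatrix, Matrix.of_apply]
  have hX : f * X 0 = 0 := MvPolynomial.funext fun v => by
    by_cases h0 : v 0 = 0
    · simp [h0]
    · rw [map_mul, ← hinv (-v 1 / v 0) v, hc, hc0]
      · simp
      · simp [quinticSubst]
        field_simp
        ring
  exact (mul_eq_zero.mp hX).resolve_right (X_ne_zero 0)

end OrbitIdeal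

/-! ### The degree eight piece -/

section DegreeEight

/-- A genericity condition: the slice matrices of `E` are invertible. -/
def HasRegularSlices (E : Fin 6 → ℂ) : Prop :=
  ∀ w < 21, (sliceMatrix w E).det ≠ 0

variable {E : Fin 6 → ℂ}

lemma eval_testPoint_eq_zero {m w i : ℕ} {f : MvPolynomial (Fin 6) ℂ} (hf : f ∈ genPiece 5 m E)
    (h : w = 20 → eval fermatQuintic f = 0) : eval (testPoint w E i) f = 0 := by
  unfold testPoint
  split_ifs with hw
  · exact h hw.1
  · exact (mem_genPiece.mp hf).1 _
      (toSlice_mem_orbitCone (quinticSubst_mem_orbitCone (self_mem_orbitCone E) (by simp)))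

lemma eq_zero_of_weight_lt (hE : HasRegularSlices E) (w : ℕ) (hw : w < 20) :
    ∀ f ∈ genPiece 5 8 E, IsWeightedHomogeneous torusWeight f w → f = 0 := by
  induction w using Nat.strong_induction_on with
  | _ w ih =>
    intro f hf hfw
    exact eq_zero_of_eval_testPoint (hE w (by omega)) (mem_genPiece.mp hf).2 hfw
      (eval_quinticSubst_upper (fun w' h => ih w' h (h.trans hw)) hf hfw)
      fun i => eval_testPoint_eq_zero hf fun h => absurd h hw.ne

lemma eq_zero_of_weight_eq (hE : HasRegularSlices E) {f : MvPolynomial (Fin 6) ℂ}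
    (hf : f ∈ genPiece 5 8 E) (hfw : IsWeightedHomogeneous torusWeight f 20)
    (h0 : eval fermatQuintic f = 0) : f = 0 :=
  eq_zero_of_eval_testPoint (hE 20 (by omega)) (mem_genPiece.mp hf).2 hfw
    (eval_quinticSubst_upper (eq_zero_of_weight_lt hE) hf hfw)
    fun _ => eval_testPoint_eq_zero hf fun _ => h0

lemma rename_rev_mem_genPiece {m : ℕ} {f : MvPolynomial (Fin 6) ℂ} (hf : f ∈ genPiece 5 m E) :
    rename Fin.rev f ∈ genPiece 5 m E := by
  rw [mem_genPiece] at hf ⊢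
  refine ⟨fun v hv => ?_, hf.2.rename_isHomogeneous⟩
  rw [eval_rename]
  exact hf.1 _ (rev_mem_orbitCone hv)

lemma eq_zero_of_lt_weight (hE : HasRegularSlices E) {w : ℕ} (hw : 20 < w)
    {f : MvPolynomial (Fin 6) ℂ} (hf : f ∈ genPiece 5 8 E)
    (hfw : IsWeightedHomogeneous torusWeight f w) : f = 0 := by
  have hg := rename_rev_mem_genPiece hf
  refine rename_injective _ Fin.rev_injective ?_
  rw [map_zero]
  refine MvPolynomial.funext fun v => ?_
  obtain ⟨P, hP, hcoeff⟩ := exists_polynomial_eval_weight torusWeight (rename Fin.rev f) v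
  have hXP : Polynomial.X ^ w * P = Polynomial.monomial 40 (eval v (rename Fin.rev f)) := by
    refine sub_eq_zero.mp (polynomial_eq_zero_of_eval_eq_zero fun c hc => ?_)
    have hrev : (fun k => c ^ torusWeight k * v k) ∘ Fin.rev =
        c ^ 5 • fun k => c⁻¹ ^ torusWeight k * (v ∘ Fin.rev) k := by
      funext k
      fin_cases k <;> simp [torusWeight, Fin.rev] <;> field_simp
    rw [Polynomial.eval_sub, Polynomial.eval_mul, hP, eval_rename, hrev,
      eval_smul_of_isHomogeneous (mem_genPiece.mp hf).2, eval_weight_smul hfw, eval_rename]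
    simp only [Polynomial.eval_pow, Polynomial.eval_X, Polynomial.eval_monomial]
    have hcw : c ^ w * c⁻¹ ^ w = 1 := by rw [← mul_pow, mul_inv_cancel₀ hc, one_pow]
    linear_combination c ^ 40 * eval (v ∘ Fin.rev) f * hcw
  rw [map_zero, ← Polynomial.coeff_monomial_same 40 (eval v (rename Fin.rev f)), ← hXP,
    Polynomial.coeff_X_pow_mul']
  split_ifs with h
  · rw [hcoeff, eq_zero_of_weight_lt hE (40 - w) (by omega) _
      (weightedHomogeneousComponent_mem_genPiece hg _)
      (weightedHomogeneousComponent_isWeightedHomogeneous _ _), map_zero]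
  · rfl

lemma eq_zero_of_eval_fermatQuintic (hE : HasRegularSlices E) {f : MvPolynomial (Fin 6) ℂ}
    (hf : f ∈ genPiece 5 8 E) (h0 : eval fermatQuintic f = 0) : f = 0 := by
  have hne (w : ℕ) (hw : w ≠ 20) : weightedHomogeneousComponent torusWeight w f = 0 := by
    have h1 := weightedHomogeneousComponent_mem_genPiece hf w
    have h2 := weightedHomogeneousComponent_isWeightedHomogeneous (w := torusWeight) w f
    rcases hw.lt_or_gt with h | h
    · exact eq_zero_of_weight_lt hE w h _ h1 h2
    · exact eq_zero_of_lt_weight hE h h1 h2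
  refine eq_zero_of_weightedHomogeneousComponent_eq_zero (ω := torusWeight) fun w => ?_
  by_cases hw : w = 20
  · subst hw
    refine eq_zero_of_weight_eq hE (weightedHomogeneousComponent_mem_genPiece hf 20)
      (weightedHomogeneousComponent_isWeightedHomogeneous 20 f) ?_
    obtain ⟨P, hP, hcoeff⟩ := exists_polynomial_eval_weight torusWeight f fermatQuintic
    have hPmon : P = Polynomial.monomial 20 (P.coeff 20) := by
      ext k
      rw [Polynomial.coeff_monomial]
      split_ifs with h
      · rw [h]
      · rw [hcoeff, hne k (Ne.symm h), map_zero]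
    have h1 := hP 1
    rw [hPmon] at h1
    simpa [h0, hcoeff] using h1
  · exact hne w hw

lemma genPiece_eq_bot_of_lt (hE : HasRegularSlices E) {m : ℕ} (hm : m < 8) :
    genPiece 5 m E = ⊥ := by
  refine (Submodule.eq_bot_iff _).mpr fun f hf => ?_
  rw [mem_genPiece] at hf
  have h : f * X 1 ^ (8 - m) = 0 := by
    refine eq_zero_of_eval_fermatQuintic hE (mem_genPiece.mpr ⟨fun v hv => ?_, ?_⟩) ?_
    · rw [map_mul, hf.1 v hv, zero_mul]
    · have := hf.2.mul (isHomogeneous_X_pow (R := ℂ) (1 : Fin 6) (8 - m))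
      rwa [Nat.add_sub_cancel' hm.le] at this
    · have : 8 - m ≠ 0 := by omega
      simp [fermatQuintic, this]
  exact (mul_eq_zero.mp h).resolve_right (pow_ne_zero _ (X_ne_zero 1))

/-- An invariant of degree eight vanishing on the orbit of `E`. -/
noncomputable def orbitInvariant (E : Fin 6 → ℂ) : MvPolynomial (Fin 6) ℂ :=
  C (invariantFour E ^ 2) * invariantEight X - C (invariantEight E) * invariantFour X ^ 2

lemma eval_orbitInvariant (v : Fin 6 → ℂ) : eval v (orbitInvariant E) =
    invariantFour E ^ 2 * invariantEight v - invariantEight E * invariantFour v ^ 2 := by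
  have hX : eval v ∘ X = v := by
    funext i
    simp
  rw [orbitInvariant, map_sub, map_mul, map_mul, eval_C, eval_C, map_pow, map_invariantFour,
    map_invariantEight, hX]

lemma invariantFour_actCoeff (g : SL2) (v : Fin 6 → ℂ) :
    invariantFour (actCoeff 5 g v) = invariantFour v :=
  apply_actCoeff_eq_of_upper_of_rev invariantFour_upper invariantFour_rev g v

lemma invariantEight_actCoeff (g : SL2) (v : Fin 6 → ℂ) :
    invariantEight (actCoeff 5 g v) = invariantEight v :=
  apply_actCoeff_eq_of_upper_of_rev invariantEight_upper invariantEight_rev g v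

lemma actPoly_orbitInvariant (g : SL2) : actPoly 5 g (orbitInvariant E) = orbitInvariant E :=
  MvPolynomial.funext fun v => by
    rw [eval_actPoly, eval_orbitInvariant, eval_orbitInvariant, invariantFour_actCoeff,
      invariantEight_actCoeff]

lemma orbitInvariant_mem_genPiece : orbitInvariant E ∈ genPiece 5 8 E := by
  refine mem_genPiece.mpr ⟨?_, isHomogeneous_of_eval_smul fun c v => ?_⟩
  · rintro _ ⟨c, g, rfl⟩
    rw [eval_orbitInvariant, invariantFour_smul, invariantEight_smul, invariantFour_actCoeff,
      invariantEight_actCoeff]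
    ring
  · rw [eval_orbitInvariant, eval_orbitInvariant, invariantFour_smul, invariantEight_smul]
    ring

lemma eval_fermatQuintic_orbitInvariant :
    eval fermatQuintic (orbitInvariant E) = -invariantEight E := by
  rw [eval_orbitInvariant]
  simp [fermatQuintic, invariantFour, invariantEight, quadPairing, quadCov, cubicHessian, cubicCov,
    hankelMinor, Matrix.det_fin_three]

lemma exists_eq_smul_orbitInvariant (hE : HasRegularSlices E) (h8 : invariantEight E ≠ 0)
    {f : MvPolynomial (Fin 6) ℂ} (hf : f ∈ genPiece 5 8 E) : ∃ c : ℂ, c • orbitInvariant E = f := by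
  refine ⟨-(eval fermatQuintic f / invariantEight E), (sub_eq_zero.mp ?_).symm⟩
  refine eq_zero_of_eval_fermatQuintic hE
    (Submodule.sub_mem _ hf (Submodule.smul_mem _ _ orbitInvariant_mem_genPiece)) ?_
  rw [map_sub, smul_eval, eval_fermatQuintic_orbitInvariant]
  field_simp
  ring

lemma finrank_genPiece_eight (hE : HasRegularSlices E) (h8 : invariantEight E ≠ 0) :
    Module.finrank ℂ (genPiece 5 8 E) = 1 := by
  refine finrank_eq_one ⟨orbitInvariant E, orbitInvariant_mem_genPiece⟩ (fun h => h8 ?_)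
    fun f => ?_
  · have h0 : orbitInvariant E = 0 := congrArg Subtype.val h
    rw [← neg_eq_zero, ← eval_fermatQuintic_orbitInvariant, h0, map_zero]
  · obtain ⟨c, hc⟩ := exists_eq_smul_orbitInvariant hE h8 f.2
    exact ⟨c, Subtype.ext hc⟩

lemma actPoly_eq_self (hE : HasRegularSlices E) (h8 : invariantEight E ≠ 0)
    {f : MvPolynomial (Fin 6) ℂ} (hf : f ∈ genPiece 5 8 E) (g : SL2) : actPoly 5 g f = f := by
  obtain ⟨c, rfl⟩ := exists_eq_smul_orbitInvariant hE h8 hf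
  rw [actPoly, map_smul]
  exact congrArg _ (actPoly_orbitInvariant g)

end DegreeEight

/-! ### Genericity -/

lemma isZariskiOpen_ne_zero {n : ℕ} (N : MvPolynomial (Fin n) ℂ) :
    IsZariskiOpen {v | eval v N ≠ 0} :=
  ⟨{N}, by simp⟩

lemma isZariskiDense_ne_zero {n : ℕ} {N : MvPolynomial (Fin n) ℂ} (hN : N ≠ 0) :
    IsZariskiDense {v | eval v N ≠ 0} := by
  refine Set.eq_univ_of_forall fun v f hf => ?_
  have h : f * N = 0 := MvPolynomial.funext fun w => by
    by_cases hw : eval w N = 0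
    · simp [hw]
    · simp [hf w hw]
  rw [(mul_eq_zero.mp h).resolve_right hN, map_zero]

/-- A polynomial whose nonvanishing guarantees that a quintic is sufficiently general. -/
noncomputable def genericityPoly : MvPolynomial (Fin 6) ℂ :=
  (∏ w ∈ Finset.range 21, (sliceMatrix w (X : Fin 6 → MvPolynomial (Fin 6) ℂ)).det) *
    invariantEight X

lemma genericityPoly_ne_zero : genericityPoly ≠ 0 := by
  refine mul_ne_zero (Finset.prod_ne_zero_iff.mpr fun w hw =>
    det_sliceMatrix_X_ne_zero (Finset.mem_range.mp hw)) fun h => ?_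
  have h1 := congrArg (eval ![1, 0, 0, 1, 0, 1]) h
  rw [map_zero, map_invariantEight] at h1
  simp [invariantEight, quadPairing, quadCov, cubicHessian, cubicCov, hankelMinor,
    Matrix.det_fin_three] at h1
  norm_num at h1

lemma hasRegularSlices_of_genericityPoly {E : Fin 6 → ℂ} (hE : eval E genericityPoly ≠ 0) :
    HasRegularSlices E ∧ invariantEight E ≠ 0 := by
  have hX : eval E ∘ X = E := by
    funext i
    simp
  rw [genericityPoly, map_mul, map_prod, map_invariantEight, hX] at hE
  refine ⟨fun w hw => ?_, right_ne_zero_of_mul hE⟩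
  have := Finset.prod_ne_zero_iff.mp (left_ne_zero_of_mul hE) w (Finset.mem_range.mpr hw)
  rwa [map_sliceMatrix, hX] at this

/-- For a general binary quintic `E` (`d = 5`): `(I_E)_m = 0` for all
`m < 8`, the degree-8 graded piece `(I_E)_8` is one-dimensional, and every polynomial in
`(I_E)_8` is `SL₂(ℂ)`-invariant (fixed by the `SL₂(ℂ)`-action on `R`). -/
theorem quintic_degree_eight_invariant :
    ForGeneral 5 fun E =>
      (∀ m : ℕ, m < 8 → genPiece 5 m E = ⊥) ∧
      Module.finrank ℂ (genPiece 5 8 E) = 1 ∧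
      ∀ f ∈ genPiece 5 8 E, ∀ g : SL2, actPoly 5 g f = f := by
  refine ⟨{E | eval E genericityPoly ≠ 0}, isZariskiOpen_ne_zero _,
    isZariskiDense_ne_zero genericityPoly_ne_zero, fun E hE => ?_⟩
  obtain ⟨hE, h8⟩ := hasRegularSlices_of_genericityPoly hE
  exact ⟨fun m hm => genPiece_eq_bot_of_lt hE hm, finrank_genPiece_eight hE h8,
    fun f hf g => actPoly_eq_self hE h8 hf g⟩
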